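/- (Lemma 2, unit-propagation form) Let V be a type of variables with decidable equality, let φ be a finite set of clauses over V, let C ∈ φ, and let C = E ∪ U be a partition of C into two disjoint sets of literals. Then the set of clauses φ ∪ { {ℓ̄} : ℓ ∈ E } (φ together with the negations of the literals of E as unit clauses) admits a unit-resolution derivation of the clause U, using at most |E| resolution steps. In particular, when E is the set of existential literals and U the set of universal literals of a clause C of a QBF matrix φ, the existential sub-clause of C is an asymmetric tautology with respect to φ: unit propagation on φ together with the negated literals of E derives the purely universal clause U. -/

import Mathlib

/-- Negation of a literal over a variable type `V`. -/
def negLit {V : Type*} (ℓ : V × Bool) : V × Bool := (ℓ.1, !ℓ.2)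

/-- `R` is the resolvent of clauses `A` and `B` on the literal `p`:
`p ∈ A`, `p̄ ∈ B`, and `R = (A \ {p}) ∪ (B \ {p̄})`. -/
def IsResolvent {V : Type*} [DecidableEq V]
    (A B R : Finset (V × Bool)) (p : V × Bool) : Prop :=
  p ∈ A ∧ negLit p ∈ B ∧ R = A.erase p ∪ B.erase (negLit p)

/-- `L` is a unit-resolution derivation from the clause set `F`: every entry of the
sequence either belongs to `F` or is a resolvent of two earlier entries, at least one
of which is a unit clause. -/
def IsUnitResDeriv {V : Type*} [DecidableEq V]
    (F : Finset (Finset (V × Bool))) (L : List (Finset (V × Bool))) : Prop :=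
  ∀ k (hk : k < L.length), L[k] ∈ F ∨
    ∃ a b, ∃ (ha : a < k) (hb : b < k), ∃ p : V × Bool,
      IsResolvent (L[a]'(ha.trans hk)) (L[b]'(hb.trans hk)) L[k] p ∧
      ((L[a]'(ha.trans hk)).card = 1 ∨ (L[b]'(hb.trans hk)).card = 1)

theorem IsUnitResDeriv.snoc_aux {V : Type*} [DecidableEq V]
    {F : Finset (Finset (V × Bool))} {L : List (Finset (V × Bool))}
    (h : IsUnitResDeriv F L) (R : Finset (V × Bool))
    (hR : R ∈ F ∨ ∃ A ∈ L, ∃ B ∈ L, ∃ p, IsResolvent A B R p ∧ (A.card = 1 ∨ B.card = 1)) :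
    IsUnitResDeriv F (L ++ [R]) := by
  intro k hk
  by_cases hkL : k < L.length
  · rcases h k hkL with h1 | ⟨a, b, ha, hb, p, h1, h2⟩
    · left
      rwa [List.getElem_append_left hkL]
    · right
      refine ⟨a, b, ha, hb, p, ?_⟩
      rw [List.getElem_append_left hkL, List.getElem_append_left (ha.trans hkL),
        List.getElem_append_left (hb.trans hkL)]
      exact ⟨h1, h2⟩
  · have hk' : k = L.length := by
      simp at hk
      omega
    subst hk'
    rcases hR with h1 | ⟨A, hA, B, hB, p, h1, h2⟩
    · left
      simpa using h1
    · right
      obtain ⟨a, ha, rfl⟩ := List.getElem_of_mem hA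
      obtain ⟨b, hb, rfl⟩ := List.getElem_of_mem hB
      refine ⟨a, b, ha, hb, p, ?_⟩
      rw [List.getElem_append_left ha, List.getElem_append_left hb]
      simpa using ⟨h1, h2⟩

theorem unitRes_aux {V : Type*} [DecidableEq V] (F : Finset (Finset (V × Bool)))
    (E : Finset (V × Bool)) :
    ∀ U : Finset (V × Bool), E ∪ U ∈ F → Disjoint E U →
      (∀ l ∈ E, ({negLit l} : Finset (V × Bool)) ∈ F) →
      ∃ L : List (Finset (V × Bool)), IsUnitResDeriv F L ∧ U ∈ L ∧
        L.countP (fun Cl => decide (Cl ∉ F)) ≤ E.card := by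
  induction E using Finset.induction_on with
  | empty =>
    intro U hU _ _
    have hU : U ∈ F := by simpa using hU
    refine ⟨[] ++ [U], IsUnitResDeriv.snoc_aux ?_ U (Or.inl hU), by simp, by simp [hU]⟩
    intro k hk
    simp at hk
  | insert e E he ih =>
    intro U hU hd hn
    rw [Finset.disjoint_insert_left] at hd
    obtain ⟨L, h1, h2, h3⟩ := ih (insert e U)
      (by rw [Finset.union_insert, ← Finset.insert_union]; exact hU)
      (by rw [Finset.disjoint_insert_right]; exact ⟨he, hd.2⟩)
      (fun l hl => hn l (Finset.mem_insert_of_mem hl))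
    have hne := hn e (Finset.mem_insert_self _ _)
    refine ⟨(L ++ [{negLit e}]) ++ [U],
      (h1.snoc_aux _ (Or.inl hne)).snoc_aux U (Or.inr ⟨insert e U, by simp [h2], {negLit e},
        by simp, e, ⟨by simp, by simp, ?_⟩, Or.inr (by simp)⟩), by simp, ?_⟩
    · simp [hd.1]
    · rw [List.countP_append, List.countP_append, Finset.card_insert_of_notMem he]
      have a1 : List.countP (fun Cl => decide (Cl ∉ F)) [({negLit e} : Finset (V × Bool))] = 0 := by
        simp [hne]
      have a2 : List.countP (fun Cl => decide (Cl ∉ F)) [U] ≤ 1 := List.countP_le_length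
      omega

/-- Lemma 2, unit-propagation form: if `C = E ∪ U ∈ φ` with `E` and `U` disjoint, then
`φ` together with the negations of the literals of `E` as unit clauses admits a
unit-resolution derivation of the clause `U`, using at most `|E|` resolution steps
(i.e. at most `|E|` entries of the sequence are resolvents rather than clauses of the
extended clause set). In particular, when `E` consists of the existential and `U` of
the universal literals of a clause `C` of a QBF matrix `φ`, the existential sub-clause
of `C` is an asymmetric tautology with respect to `φ`. -/
theorem existential_subclause_AT {V : Type*} [DecidableEq V]
    (φ : Finset (Finset (V × Bool))) (C E U : Finset (V × Bool))
    (hC : C ∈ φ) (hCEU : C = E ∪ U) (hdisj : Disjoint E U) :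
    ∃ L : List (Finset (V × Bool)),
      IsUnitResDeriv (φ ∪ E.image (fun ℓ => ({negLit ℓ} : Finset (V × Bool)))) L ∧
      U ∈ L ∧
      L.countP
        (fun Cl =>
          decide (Cl ∉ φ ∪ E.image (fun ℓ => ({negLit ℓ} : Finset (V × Bool)))))
        ≤ E.card := by
  subst hCEU
  refine unitRes_aux _ E U (Finset.mem_union_left _ hC) hdisj ?_
  intro l hl
  exact Finset.mem_union_right _ (Finset.mem_image_of_mem _ hl)
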